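/- arXiv:2405.15090 — 5 statements merged into one kernel-verified Lean document; each statement's English description precedes it below -/
import Mathlib

section
/- Let K, K_0, L, N be integers with 1 ≤ K_0 ≤ K, K ≥ 2, L ≥ 1 and N ≥ K_0. Define Ψ := Σ_{j=1}^{K_0} 1/max(2, j−L) (a positive real), and for k = 1, …, K−1 define n_k := ⌈(N − K_0) / (Ψ · (K + 1 − k))⌉, and set n_k := n_{K−1} for K−1 < k ≤ K+L. Then Σ_{k = K−K_0+L+1}^{K+L} n_k ≤ N. (This is the arithmetic content of Proposition 1: the total number of arm pulls of the SFSR algorithm never exceeds the budget N.) -/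
/-- **Proposition 1 (budget).** Let `K, K₀, L, N` be integers with `1 ≤ K₀ ≤ K`, `K ≥ 2`,
`L ≥ 1`, `N ≥ K₀`.  With `Ψ := Σ_{j=1}^{K₀} 1 / max(2, j − L)` and
`n_k := ⌈(N − K₀) / (Ψ (K + 1 − k))⌉` for `1 ≤ k ≤ K − 1`, extended by
`n_k := n_{K−1}` for `K − 1 < k ≤ K + L`, the total number of arm pulls
`Σ_{k = K−K₀+L+1}^{K+L} n_k` never exceeds the budget `N`. -/
theorem sfsr_budget
    (K K₀ L N : ℕ) (hK₀pos : 1 ≤ K₀) (hK₀K : K₀ ≤ K) (hK : 2 ≤ K) (hL : 1 ≤ L)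
    (hN : K₀ ≤ N)
    (Ψ : ℝ)
    (hΨ : Ψ = ∑ j ∈ Finset.Icc 1 K₀, (1 : ℝ) / ((max 2 ((j : ℤ) - (L : ℤ)) : ℤ) : ℝ))
    (n : ℕ → ℤ)
    (hn : ∀ k, 1 ≤ k → k ≤ K - 1 →
      n k = ⌈((N : ℝ) - (K₀ : ℝ)) / (Ψ * ((K : ℝ) + 1 - (k : ℝ)))⌉)
    (hn' : ∀ k, K - 1 < k → k ≤ K + L → n k = n (K - 1)) :
    ∑ k ∈ Finset.Icc (K - K₀ + L + 1) (K + L), n k ≤ (N : ℤ) := by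
  set m : ℕ → ℝ := fun j => ((max 2 ((j : ℤ) - (L : ℤ)) : ℤ) : ℝ) with hm
  have hmpos : ∀ j, 0 < m j := by
    intro j
    have h : (0 : ℤ) < max 2 ((j : ℤ) - (L : ℤ)) := lt_of_lt_of_le (by norm_num) (le_max_left _ _)
    exact Int.cast_pos.mpr h
  have hΨ2 : Ψ = ∑ j ∈ Finset.Icc 1 K₀, 1 / m j := hΨ
  have hΨpos : 0 < Ψ := by
    rw [hΨ2]
    apply Finset.sum_pos
    · intro j _
      exact one_div_pos.mpr (hmpos j)
    · exact ⟨1, by simp; omega⟩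
  have hre : ∑ k ∈ Finset.Icc (K - K₀ + L + 1) (K + L), n k
      = ∑ j ∈ Finset.Icc 1 K₀, n (K + L + 1 - j) := by
    refine Finset.sum_nbij' (fun k => K + L + 1 - k) (fun j => K + L + 1 - j) ?_ ?_ ?_ ?_ ?_
    · intro a ha; simp only [Finset.mem_Icc] at *; omega
    · intro a ha; simp only [Finset.mem_Icc] at *; omega
    · intro a ha; simp only [Finset.mem_Icc] at *; omega
    · intro a ha; simp only [Finset.mem_Icc] at *; omega
    · intro a ha
      simp only [Finset.mem_Icc] at *
      congr 1; omega
  have hval : ∀ j ∈ Finset.Icc 1 K₀,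
      n (K + L + 1 - j) = ⌈((N : ℝ) - (K₀ : ℝ)) / (Ψ * m j)⌉ := by
    intro j hj
    rw [Finset.mem_Icc] at hj
    by_cases hjL : L + 2 ≤ j
    · rw [hn _ (by omega) (by omega)]
      have : m j = (K : ℝ) + 1 - ((K + L + 1 - j : ℕ) : ℝ) := by
        simp only [hm]
        rw [max_eq_right (by omega), Nat.cast_sub (by omega)]
        push_cast
        ring
      rw [this]
    · rw [hn' _ (by omega) (by omega), hn _ (by omega) le_rfl]
      have : m j = (K : ℝ) + 1 - ((K - 1 : ℕ) : ℝ) := by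
        simp only [hm]
        rw [max_eq_left (by omega), Nat.cast_sub (by omega)]
        push_cast
        ring
      rw [this]
  rw [hre, Finset.sum_congr rfl hval]
  have key : ((∑ j ∈ Finset.Icc 1 K₀, ⌈((N : ℝ) - (K₀ : ℝ)) / (Ψ * m j)⌉ : ℤ) : ℝ) ≤ (N : ℝ) := by
    push_cast
    calc ∑ j ∈ Finset.Icc 1 K₀, (⌈((N : ℝ) - (K₀ : ℝ)) / (Ψ * m j)⌉ : ℝ)
        ≤ ∑ j ∈ Finset.Icc 1 K₀, (((N : ℝ) - (K₀ : ℝ)) / Ψ * (1 / m j) + 1) := by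
          apply Finset.sum_le_sum
          intro j _
          have h := (Int.ceil_lt_add_one (((N : ℝ) - (K₀ : ℝ)) / (Ψ * m j))).le
          rwa [div_mul_div_comm, mul_one]
      _ = ((N : ℝ) - (K₀ : ℝ)) / Ψ * Ψ + K₀ := by
          rw [Finset.sum_add_distrib, ← Finset.mul_sum, ← hΨ2]
          simp
      _ = N := by
          rw [div_mul_cancel₀ _ hΨpos.ne']
          ring
  exact_mod_cast key
end

section
/- Under Assumption 1, for every basis J ⊆ [K+L] with |J| = L+1, one has J ≠ I* if and only if Δ_J² > 0 (where Δ_J² = +∞ counts as > 0). Equivalently, Δ_J² = 0 if and only if J = I*. -/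
open Matrix
open scoped ENNReal NNReal

noncomputable section

/-- The objective vector `μ ∈ ℝ^{K+L}` of the standard-form LP: `μ_a = r_a` for `a ∈ [K]`
and `μ_{K+l} = 0` for `l ∈ [L]`. -/
def lpMu {K L : ℕ} (r : Fin K → ℝ) : Fin (K + L) → ℝ :=
  fun a => if ha : (a : ℕ) < K then r ⟨a, ha⟩ else 0

/-- The `(L+1) × (K+L)` constraint matrix `A` of the standard-form LP: the first `L` rows are
`(c, I_{L×L})` and the last row is `(1_K^T, 0_L^T)`. -/
def lpA {K L : ℕ} (c : Fin L → Fin K → ℝ) : Matrix (Fin (L + 1)) (Fin (K + L)) ℝ :=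
  Matrix.of fun l a =>
    if hl : (l : ℕ) < L then
      if ha : (a : ℕ) < K then c ⟨l, hl⟩ ⟨a, ha⟩
      else if (a : ℕ) = K + (l : ℕ) then 1 else 0
    else if (a : ℕ) < K then 1 else 0

/-- The right-hand side `b = (c̄, 1) ∈ ℝ^{L+1}`. -/
def lpb {L : ℕ} (cbar : Fin L → ℝ) : Fin (L + 1) → ℝ :=
  fun l => if hl : (l : ℕ) < L then cbar ⟨l, hl⟩ else 1

/-- Feasibility for the standard-form LP: `x ≥ 0` and `A x = b`. -/
def IsFeasible {K L : ℕ} (c : Fin L → Fin K → ℝ) (cbar : Fin L → ℝ)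
    (x : Fin (K + L) → ℝ) : Prop :=
  (∀ i, 0 ≤ x i) ∧ lpA c *ᵥ x = lpb cbar

/-- Optimality for the standard-form LP `max {μ^T x : A x = b, x ≥ 0}`. -/
def IsOptimal {K L : ℕ} (r : Fin K → ℝ) (c : Fin L → Fin K → ℝ) (cbar : Fin L → ℝ)
    (x : Fin (K + L) → ℝ) : Prop :=
  IsFeasible c cbar x ∧ ∀ y, IsFeasible c cbar y → lpMu (L := L) r ⬝ᵥ y ≤ lpMu (L := L) r ⬝ᵥ x

open Classical in
/-- The support of a vector, as a finset. -/
def lpSupport {n : ℕ} (x : Fin n → ℝ) : Finset (Fin n) :=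
  Finset.univ.filter fun a => x a ≠ 0

/-- The square submatrix `A_J` formed by the columns of `A` indexed by the basis `J`
(in increasing order). -/
def subCols {K L : ℕ} (A : Matrix (Fin (L + 1)) (Fin (K + L)) ℝ)
    (J : Finset (Fin (K + L))) (hJ : J.card = L + 1) :
    Matrix (Fin (L + 1)) (Fin (L + 1)) ℝ :=
  Matrix.of fun i j => A i ((J.orderIsoOfFin hJ j : J) : Fin (K + L))

/-- The subvector `μ_J` formed by the coordinates of `μ` indexed by the basis `J`
(in increasing order). -/
def subVec {K L : ℕ} (μ : Fin (K + L) → ℝ) (J : Finset (Fin (K + L)))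
    (hJ : J.card = L + 1) : Fin (L + 1) → ℝ :=
  fun j => μ ((J.orderIsoOfFin hJ j : J) : Fin (K + L))

/-- A basis `J` is feasible for `(A, b)` if `A_J` is invertible and `A_J^{-1} b ≥ 0`. -/
def BasisFeasible {K L : ℕ} (A : Matrix (Fin (L + 1)) (Fin (K + L)) ℝ)
    (b : Fin (L + 1) → ℝ) (J : Finset (Fin (K + L))) (hJ : J.card = L + 1) : Prop :=
  IsUnit (subCols A J hJ) ∧ ∀ i, 0 ≤ ((subCols A J hJ)⁻¹ *ᵥ b) i

/-- The value `μ_J^T A_J^{-1} b` of the basic solution corresponding to the basis `J`. -/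
def basisValue {K L : ℕ} (μ : Fin (K + L) → ℝ) (A : Matrix (Fin (L + 1)) (Fin (K + L)) ℝ)
    (b : Fin (L + 1) → ℝ) (J : Finset (Fin (K + L))) (hJ : J.card = L + 1) : ℝ :=
  subVec μ J hJ ⬝ᵥ ((subCols A J hJ)⁻¹ *ᵥ b)

/-- Replace the rewards of the first `K₀` arms by `rt`. -/
def modR {K K₀ : ℕ} (r : Fin K → ℝ) (rt : Fin K₀ → ℝ) : Fin K → ℝ :=
  fun a => if ha : (a : ℕ) < K₀ then rt ⟨a, ha⟩ else r a

/-- Replace the costs of the first `K₀` arms by `ct`. -/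
def modC {K L K₀ : ℕ} (c : Fin L → Fin K → ℝ) (ct : Fin L → Fin K₀ → ℝ) :
    Fin L → Fin K → ℝ :=
  fun l a => if ha : (a : ℕ) < K₀ then ct l ⟨a, ha⟩ else c l a

/-- The basis value gap `Δ_J²` (equation (8) of the paper), as an extended nonnegative real,
with `inf ∅ = +∞`. -/
def gapBasis {K L : ℕ} (K₀ : ℕ) (hK₀ : K₀ ≤ K) (σr σc : ℝ) (r : Fin K → ℝ)
    (c : Fin L → Fin K → ℝ) (cbar : Fin L → ℝ) (Istar J : Finset (Fin (K + L)))
    (hI : Istar.card = L + 1) (hJ : J.card = L + 1) : ℝ≥0∞ :=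
  sInf { x : ℝ≥0∞ | ∃ (rt : Fin K₀ → ℝ) (ct : Fin L → Fin K₀ → ℝ),
    BasisFeasible (lpA (modC c ct)) (lpb cbar) Istar hI ∧
    BasisFeasible (lpA (modC c ct)) (lpb cbar) J hJ ∧
    basisValue (lpMu (modR r rt)) (lpA (modC c ct)) (lpb cbar) Istar hI ≤
      basisValue (lpMu (modR r rt)) (lpA (modC c ct)) (lpb cbar) J hJ ∧
    x = ENNReal.ofReal ((σr ^ 2)⁻¹ * ∑ a : Fin K₀, (r (Fin.castLE hK₀ a) - rt a) ^ 2
          + (σc ^ 2)⁻¹ * ∑ l : Fin L, ∑ a : Fin K₀, (c l (Fin.castLE hK₀ a) - ct l a) ^ 2) }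

/-- The arm value gap `Δ_a²` (equation (9) of the paper): the minimum of `Δ_J²` over all
bases `J` containing `a`. -/
def gapArm {K L : ℕ} (K₀ : ℕ) (hK₀ : K₀ ≤ K) (σr σc : ℝ) (r : Fin K → ℝ)
    (c : Fin L → Fin K → ℝ) (cbar : Fin L → ℝ) (Istar : Finset (Fin (K + L)))
    (hI : Istar.card = L + 1) (a : Fin (K + L)) : ℝ≥0∞ :=
  ⨅ (J : Finset (Fin (K + L))) (hJ : J.card = L + 1) (_ : a ∈ J),
    gapBasis K₀ hK₀ σr σc r c cbar Istar J hI hJ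

/-- The optimal support infeasibility gap `Δ₀²` (equation (10) of the paper), as an extended
nonnegative real, with `inf ∅ = +∞`. -/
def gapZero {K L : ℕ} (K₀ : ℕ) (hK₀ : K₀ ≤ K) (σc : ℝ) (c : Fin L → Fin K → ℝ)
    (cbar : Fin L → ℝ) (Istar : Finset (Fin (K + L))) (hI : Istar.card = L + 1) : ℝ≥0∞ :=
  sInf { x : ℝ≥0∞ | ∃ ct : Fin L → Fin K₀ → ℝ,
    (¬ IsUnit (subCols (lpA (modC c ct)) Istar hI) ∨
      ∃ i, ((subCols (lpA (modC c ct)) Istar hI)⁻¹ *ᵥ lpb cbar) i < 0) ∧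
    x = ENNReal.ofReal
          ((σc ^ 2)⁻¹ * ∑ l : Fin L, ∑ a : Fin K₀, (c l (Fin.castLE hK₀ a) - ct l a) ^ 2) }


lemma lpA_continuous {K L : ℕ} :
    Continuous (fun c : Fin L → Fin K → ℝ => lpA (K := K) (L := L) c) := by
  refine continuous_pi fun i => continuous_pi fun j => ?_
  simp only [lpA, Matrix.of_apply]
  split_ifs <;> fun_prop

lemma lpMu_continuous {K L : ℕ} :
    Continuous (fun r : Fin K → ℝ => lpMu (K := K) (L := L) r) := by
  refine continuous_pi fun j => ?_
  simp only [lpMu]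
  split_ifs <;> fun_prop

/-- Direction in the kernel supported in the optimal support vanishes. -/
lemma kernel_zero {K L : ℕ} (r : Fin K → ℝ) (c : Fin L → Fin K → ℝ) (cbar : Fin L → ℝ)
    (xs : Fin (K + L) → ℝ) (hopt : IsOptimal r c cbar xs)
    (huniq : ∀ y, IsOptimal r c cbar y → y = xs)
    (d : Fin (K + L) → ℝ) (hd : lpA c *ᵥ d = 0) (hs : ∀ a, xs a = 0 → d a = 0) : d = 0 := by
  have key : ∃ t : ℝ, 0 < t ∧ ∀ a, t * |d a| ≤ xs a := by
    have h1 : ∀ a, ∃ t : ℝ, 0 < t ∧ t * |d a| ≤ xs a := by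
      intro a
      by_cases h : xs a = 0
      · exact ⟨1, one_pos, by simp [h, hs a h]⟩
      · have hp : 0 < xs a := lt_of_le_of_ne (hopt.1.1 a) (Ne.symm h)
        refine ⟨xs a / (|d a| + 1), by positivity, ?_⟩
        rw [div_mul_eq_mul_div, div_le_iff₀ (by positivity)]
        nlinarith [abs_nonneg (d a)]
    choose t ht0 ht using h1
    rcases isEmpty_or_nonempty (Fin (K + L)) with he | he
    · exact ⟨1, one_pos, fun a => he.elim a⟩
    · obtain ⟨a0, ha0⟩ := Finite.exists_min t
      exact ⟨t a0, ht0 a0, fun a =>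
        (mul_le_mul_of_nonneg_right (ha0 a) (abs_nonneg _)).trans (ht a)⟩
  obtain ⟨t, ht0, ht⟩ := key
  have f1 : IsFeasible c cbar (xs + t • d) := by
    refine ⟨fun a => ?_, ?_⟩
    · have := ht a
      have h2 := neg_abs_le (d a)
      simp only [Pi.add_apply, Pi.smul_apply, smul_eq_mul]
      nlinarith
    · rw [mulVec_add, mulVec_smul, hd, hopt.1.2]; simp
  have f2 : IsFeasible c cbar (xs - t • d) := by
    refine ⟨fun a => ?_, ?_⟩
    · have := ht a
      have h2 := le_abs_self (d a)
      simp only [Pi.sub_apply, Pi.smul_apply, smul_eq_mul]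
      nlinarith
    · rw [mulVec_sub, mulVec_smul, hd, hopt.1.2]; simp
  have v2 := hopt.2 _ f2
  have o1 : IsOptimal r c cbar (xs + t • d) := by
    refine ⟨f1, fun y hy => (hopt.2 y hy).trans ?_⟩
    rw [dotProduct_sub] at v2
    rw [dotProduct_add]
    linarith
  have := huniq _ o1
  have h3 : t • d = 0 := by simpa using this
  exact (smul_eq_zero.mp h3).resolve_left ht0.ne'

/-- Extension by zero of a vector indexed by a basis. -/
def extVec {K L : ℕ} (J : Finset (Fin (K + L))) (hJ : J.card = L + 1) (y : Fin (L + 1) → ℝ) :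
    Fin (K + L) → ℝ :=
  fun a => ∑ j, if ((J.orderIsoOfFin hJ j : J) : Fin (K + L)) = a then y j else 0

lemma dot_extVec {K L : ℕ} (J : Finset (Fin (K + L))) (hJ : J.card = L + 1)
    (y : Fin (L + 1) → ℝ) (f : Fin (K + L) → ℝ) :
    f ⬝ᵥ extVec J hJ y = subVec f J hJ ⬝ᵥ y := by
  simp only [dotProduct, extVec, subVec, Finset.mul_sum]
  rw [Finset.sum_comm]
  refine Finset.sum_congr rfl fun j _ => ?_
  rw [Finset.sum_eq_single ((J.orderIsoOfFin hJ j : J) : Fin (K + L))]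
  · rw [if_pos rfl]
  · intro a _ ha
    rw [if_neg (Ne.symm ha), mul_zero]
  · intro h
    exact absurd (Finset.mem_univ _) h

lemma mulVec_extVec {K L : ℕ} (J : Finset (Fin (K + L))) (hJ : J.card = L + 1)
    (y : Fin (L + 1) → ℝ) (A : Matrix (Fin (L + 1)) (Fin (K + L)) ℝ) :
    A *ᵥ extVec J hJ y = subCols A J hJ *ᵥ y := by
  ext i
  exact dot_extVec J hJ y (A i)

lemma extVec_supp {K L : ℕ} (J : Finset (Fin (K + L))) (hJ : J.card = L + 1)
    (y : Fin (L + 1) → ℝ) (a : Fin (K + L)) (ha : a ∉ J) : extVec J hJ y a = 0 := by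
  refine Finset.sum_eq_zero fun j _ => if_neg ?_
  rintro rfl
  exact ha (J.orderIsoOfFin hJ j).2

lemma extVec_apply {K L : ℕ} (J : Finset (Fin (K + L))) (hJ : J.card = L + 1)
    (y : Fin (L + 1) → ℝ) (j : Fin (L + 1)) :
    extVec J hJ y ((J.orderIsoOfFin hJ j : J) : Fin (K + L)) = y j := by
  simp [extVec]

lemma extVec_surj {K L : ℕ} (J : Finset (Fin (K + L))) (hJ : J.card = L + 1)
    (x : Fin (K + L) → ℝ) (hx : ∀ a, a ∉ J → x a = 0) : extVec J hJ (subVec x J hJ) = x := by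
  ext a
  by_cases ha : a ∈ J
  · obtain ⟨j, hj⟩ := (J.orderIsoOfFin hJ).surjective ⟨a, ha⟩
    have : a = ((J.orderIsoOfFin hJ j : J) : Fin (K + L)) := by rw [hj]
    rw [this, extVec_apply]; rfl
  · rw [extVec_supp _ _ _ _ ha, hx a ha]

lemma extVec_feasible {K L : ℕ} (c : Fin L → Fin K → ℝ) (cbar : Fin L → ℝ)
    (J : Finset (Fin (K + L))) (hJ : J.card = L + 1)
    (h : BasisFeasible (lpA c) (lpb cbar) J hJ) :
    IsFeasible c cbar (extVec J hJ ((subCols (lpA c) J hJ)⁻¹ *ᵥ lpb cbar)) := by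
  refine ⟨fun a => Finset.sum_nonneg fun j _ => ?_, ?_⟩
  · split_ifs
    · exact h.2 j
    · exact le_rfl
  · rw [mulVec_extVec, mulVec_mulVec,
      Matrix.mul_nonsing_inv _ ((Matrix.isUnit_iff_isUnit_det _).mp h.1), one_mulVec]

lemma feasible_bound {K L : ℕ} (c c' : Fin L → Fin K → ℝ) (cbar : Fin L → ℝ)
    (hc : dist c' c < 1) (x : Fin (K + L) → ℝ) (hx : IsFeasible c' cbar x) :
    ∀ a, x a ≤ 1 + ‖cbar‖ + K * (‖c‖ + 1) := by
  have hsum : ∑ a : Fin K, x (Fin.castAdd L a) = 1 := by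
    have := congrFun hx.2 (Fin.last L)
    simpa [lpA, lpb, mulVec, dotProduct, Fin.sum_univ_add] using this
  have hle : ∀ a : Fin K, x (Fin.castAdd L a) ≤ 1 := by
    intro a
    rw [← hsum]
    exact Finset.single_le_sum (f := fun a : Fin K => x (Fin.castAdd L a))
      (fun i _ => hx.1 _) (Finset.mem_univ a)
  have hn : ∀ l a, |c' l a| ≤ ‖c‖ + 1 := by
    intro l a
    have h1 : ‖c' l a‖ ≤ ‖c'‖ := (norm_le_pi_norm (c' l) a).trans (norm_le_pi_norm c' l)
    have h2 : ‖c'‖ ≤ ‖c‖ + ‖c' - c‖ := by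
      have := norm_add_le c (c' - c)
      simpa using this
    rw [dist_eq_norm] at hc
    rw [← Real.norm_eq_abs]; linarith
  intro a
  refine Fin.addCases (fun a => ?_) (fun l => ?_) a
  · have := hle a
    have : 0 ≤ ‖cbar‖ := norm_nonneg _
    have : (0:ℝ) ≤ K * (‖c‖ + 1) := by positivity
    linarith [hle a]
  · have h := congrFun hx.2 l.castSucc
    have h' : ∑ a : Fin K, c' l a * x (Fin.castAdd L a) + x (Fin.natAdd K l) = cbar l := by
      simpa [lpA, lpb, mulVec, dotProduct, Fin.sum_univ_add, Fin.val_inj, eq_comm] using h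
    have h2 : -(K * (‖c‖ + 1)) ≤ ∑ a : Fin K, c' l a * x (Fin.castAdd L a) := by
      have : ∑ a : Fin K, (-(‖c‖ + 1)) ≤ ∑ a : Fin K, c' l a * x (Fin.castAdd L a) := by
        refine Finset.sum_le_sum fun a _ => ?_
        have h3 := (abs_le.mp (hn l a)).1
        have h4 := hle a
        have h5 := hx.1 (Fin.castAdd L a)
        nlinarith [norm_nonneg c]
      rw [Finset.sum_const, Finset.card_univ, Fintype.card_fin, nsmul_eq_mul] at this
      linarith
    have h6 : cbar l ≤ ‖cbar‖ := (le_abs_self _).trans (norm_le_pi_norm cbar l)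
    linarith

lemma core {K L : ℕ} (r : Fin K → ℝ) (c : Fin L → Fin K → ℝ) (cbar : Fin L → ℝ)
    (xs : Fin (K + L) → ℝ) (hopt : IsOptimal r c cbar xs)
    (huniq : ∀ y, IsOptimal r c cbar y → y = xs)
    (J : Finset (Fin (K + L)))
    (H : ∀ ε : ℝ, 0 < ε → ∃ (r' : Fin K → ℝ) (c' : Fin L → Fin K → ℝ) (x z : Fin (K + L) → ℝ),
      dist r' r < ε ∧ dist c' c < ε ∧ IsFeasible c' cbar x ∧ IsFeasible c' cbar z ∧
      (∀ a, a ∉ J → x a = 0) ∧ (∀ a, xs a = 0 → z a = 0) ∧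
      lpMu (L := L) r' ⬝ᵥ z ≤ lpMu (L := L) r' ⬝ᵥ x) :
    ∀ a, a ∉ J → xs a = 0 := by
  have H' := fun n : ℕ => H (1 / ((n : ℝ) + 1)) Nat.one_div_pos_of_nat
  choose r' c' x z hr hc hx hz hxs hzs hv using H'
  have hr' : Filter.Tendsto r' Filter.atTop (nhds r) :=
    tendsto_iff_dist_tendsto_zero.mpr (squeeze_zero (fun _ => dist_nonneg) (fun n => (hr n).le)
      tendsto_one_div_add_atTop_nhds_zero_nat)
  have hc' : Filter.Tendsto c' Filter.atTop (nhds c) :=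
    tendsto_iff_dist_tendsto_zero.mpr (squeeze_zero (fun _ => dist_nonneg) (fun n => (hc n).le)
      tendsto_one_div_add_atTop_nhds_zero_nat)
  have hc1 : ∀ n, dist (c' n) c < 1 := fun n => (hc n).trans_le (by
    rw [div_le_one (by positivity)]; simp)
  set M : ℝ := 1 + ‖cbar‖ + K * (‖c‖ + 1)
  have hcomp : IsCompact (Set.Icc (0 : Fin (K + L) → ℝ) (fun _ => M) ×ˢ
      Set.Icc (0 : Fin (K + L) → ℝ) (fun _ => M)) := isCompact_Icc.prod isCompact_Icc
  obtain ⟨⟨x0, z0⟩, -, φ, hφ, hlim⟩ := hcomp.tendsto_subseq (x := fun n => (x n, z n)) (fun n =>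
    ⟨⟨fun a => (hx n).1 a, fun a => feasible_bound c (c' n) cbar (hc1 n) _ (hx n) a⟩,
     ⟨fun a => (hz n).1 a, fun a => feasible_bound c (c' n) cbar (hc1 n) _ (hz n) a⟩⟩)
  have hxl : Filter.Tendsto (fun n => x (φ n)) Filter.atTop (nhds x0) :=
    (continuous_fst.tendsto _).comp hlim
  have hzl : Filter.Tendsto (fun n => z (φ n)) Filter.atTop (nhds z0) :=
    (continuous_snd.tendsto _).comp hlim
  have hrl := hr'.comp hφ.tendsto_atTop
  have hcl := hc'.comp hφ.tendsto_atTop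
  have hcontA : Continuous (fun p : (Fin L → Fin K → ℝ) × (Fin (K + L) → ℝ) =>
      lpA p.1 *ᵥ p.2) := (lpA_continuous.comp continuous_fst).matrix_mulVec continuous_snd
  have hcontM : Continuous (fun p : (Fin K → ℝ) × (Fin (K + L) → ℝ) =>
      lpMu (L := L) p.1 ⬝ᵥ p.2) := (lpMu_continuous.comp continuous_fst).dotProduct continuous_snd
  have feas : ∀ (y : ℕ → Fin (K + L) → ℝ) (y0 : Fin (K + L) → ℝ),
      (∀ n, IsFeasible (c' n) cbar (y n)) →
      Filter.Tendsto (fun n => y (φ n)) Filter.atTop (nhds y0) → IsFeasible c cbar y0 := by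
    intro y y0 hy hyl
    refine ⟨fun a => ge_of_tendsto' (tendsto_pi_nhds.mp hyl a) fun n => (hy _).1 a, ?_⟩
    have h1 := (hcontA.tendsto (c, y0)).comp (hcl.prodMk_nhds hyl)
    refine tendsto_nhds_unique h1 ?_
    refine tendsto_const_nhds.congr fun n => ?_
    exact (hy (φ n)).2.symm
  have supp : ∀ (y : ℕ → Fin (K + L) → ℝ) (y0 : Fin (K + L) → ℝ) (a : Fin (K + L)),
      (∀ n, y n a = 0) →
      Filter.Tendsto (fun n => y (φ n)) Filter.atTop (nhds y0) → y0 a = 0 := by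
    intro y y0 a hy hyl
    refine tendsto_nhds_unique (tendsto_pi_nhds.mp hyl a) ?_
    simp [hy]
  have fx := feas x x0 hx hxl
  have fz := feas z z0 hz hzl
  have hval : lpMu (L := L) r ⬝ᵥ z0 ≤ lpMu (L := L) r ⬝ᵥ x0 :=
    le_of_tendsto_of_tendsto' ((hcontM.tendsto (r, z0)).comp (hrl.prodMk_nhds hzl))
      ((hcontM.tendsto (r, x0)).comp (hrl.prodMk_nhds hxl)) (fun n => hv (φ n))
  have hz0 : z0 - xs = 0 := by
    refine kernel_zero r c cbar xs hopt huniq _ ?_ ?_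
    · rw [mulVec_sub, fz.2, hopt.1.2, sub_self]
    · intro a ha
      simp [ha, supp z z0 a (fun n => hzs n a ha) hzl]
  rw [sub_eq_zero] at hz0
  have hx0 : x0 = xs := huniq _ ⟨fx, fun y hy => (hopt.2 y hy).trans (hz0 ▸ hval)⟩
  intro a ha
  rw [← hx0]
  exact supp x x0 a (fun n => hxs n a ha) hxl

/-- **Proposition 2.** Under Assumption 1, a basis `J` satisfies `J ≠ I*` if and only if
`Δ_J² > 0` (with `Δ_J² = +∞` counting as positive); equivalently, `Δ_J² = 0` iff `J = I*`. -/
theorem gap_pos_iff_ne_optimal_basis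
    (K L K₀ : ℕ) (hK : 0 < K) (hL : 0 < L) (hK₀pos : 0 < K₀) (hK₀ : K₀ ≤ K)
    (σr σc : ℝ) (hσr : 0 < σr) (hσc : 0 < σc)
    (r : Fin K → ℝ) (c : Fin L → Fin K → ℝ) (cbar : Fin L → ℝ)
    (xstar : Fin (K + L) → ℝ)
    (hopt : IsOptimal r c cbar xstar)
    (huniq : ∀ y, IsOptimal r c cbar y → y = xstar)
    (hsupp : (lpSupport xstar).card = L + 1)
    (J : Finset (Fin (K + L))) (hJ : J.card = L + 1) :
    J ≠ lpSupport xstar ↔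
      0 < gapBasis K₀ hK₀ σr σc r c cbar (lpSupport xstar) J hsupp hJ := by
  constructor
  · intro hne
    rw [pos_iff_ne_zero]
    intro h0
    apply hne
    have hsub : ∀ a, a ∉ J → xstar a = 0 := by
      refine core r c cbar xstar hopt huniq J ?_
      intro ε hε
      set δ : ℝ := min ((σr ^ 2)⁻¹ * (ε / 2) ^ 2) ((σc ^ 2)⁻¹ * (ε / 2) ^ 2) with hδ
      have hδ0 : 0 < δ := by positivity
      have hlt : gapBasis K₀ hK₀ σr σc r c cbar (lpSupport xstar) J hsupp hJ
          < ENNReal.ofReal δ := by rw [h0]; exact ENNReal.ofReal_pos.mpr hδ0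
      obtain ⟨w, ⟨rt, ct, hI, hJf, hv, rfl⟩, hw⟩ := sInf_lt_iff.mp hlt
      have hw' := (ENNReal.ofReal_lt_ofReal_iff hδ0).mp hw
      have hS1 : 0 ≤ (σr ^ 2)⁻¹ * ∑ a : Fin K₀, (r (Fin.castLE hK₀ a) - rt a) ^ 2 := by positivity
      have hS2 : 0 ≤ (σc ^ 2)⁻¹ *
          ∑ l : Fin L, ∑ a : Fin K₀, (c l (Fin.castLE hK₀ a) - ct l a) ^ 2 := by positivity
      have hA1 : ∑ a : Fin K₀, (r (Fin.castLE hK₀ a) - rt a) ^ 2 ≤ (ε / 2) ^ 2 := by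
        have : (σr ^ 2)⁻¹ * ∑ a : Fin K₀, (r (Fin.castLE hK₀ a) - rt a) ^ 2
            ≤ (σr ^ 2)⁻¹ * (ε / 2) ^ 2 := by
          linarith [min_le_left ((σr ^ 2)⁻¹ * (ε / 2) ^ 2) ((σc ^ 2)⁻¹ * (ε / 2) ^ 2)]
        exact le_of_mul_le_mul_left this (by positivity)
      have hA2 : ∑ l : Fin L, ∑ a : Fin K₀, (c l (Fin.castLE hK₀ a) - ct l a) ^ 2
          ≤ (ε / 2) ^ 2 := by
        have : (σc ^ 2)⁻¹ * ∑ l : Fin L, ∑ a : Fin K₀, (c l (Fin.castLE hK₀ a) - ct l a) ^ 2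
            ≤ (σc ^ 2)⁻¹ * (ε / 2) ^ 2 := by
          linarith [min_le_right ((σr ^ 2)⁻¹ * (ε / 2) ^ 2) ((σc ^ 2)⁻¹ * (ε / 2) ^ 2)]
        exact le_of_mul_le_mul_left this (by positivity)
      have hB1 : ∀ a : Fin K₀, |r (Fin.castLE hK₀ a) - rt a| ≤ ε / 2 := by
        intro a
        refine abs_le_of_sq_le_sq (le_trans ?_ hA1) (by positivity)
        exact Finset.single_le_sum (f := fun a : Fin K₀ => (r (Fin.castLE hK₀ a) - rt a) ^ 2)
          (fun i _ => sq_nonneg _) (Finset.mem_univ a)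
      have hB2 : ∀ (l : Fin L) (a : Fin K₀), |c l (Fin.castLE hK₀ a) - ct l a| ≤ ε / 2 := by
        intro l a
        refine abs_le_of_sq_le_sq (le_trans ?_ hA2) (by positivity)
        refine le_trans (Finset.single_le_sum
          (f := fun a : Fin K₀ => (c l (Fin.castLE hK₀ a) - ct l a) ^ 2)
          (fun i _ => sq_nonneg _) (Finset.mem_univ a)) ?_
        exact Finset.single_le_sum
          (f := fun l : Fin L => ∑ a : Fin K₀, (c l (Fin.castLE hK₀ a) - ct l a) ^ 2)
          (fun i _ => Finset.sum_nonneg fun _ _ => sq_nonneg _) (Finset.mem_univ l)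
      refine ⟨modR r rt, modC c ct, _, _, ?_, ?_, extVec_feasible _ _ J hJ hJf,
        extVec_feasible _ _ _ hsupp hI, extVec_supp _ _ _, ?_, ?_⟩
      · refine lt_of_le_of_lt ((dist_pi_le_iff (by positivity)).mpr fun a => ?_) (half_lt_self hε)
        rw [Real.dist_eq, abs_sub_comm]
        unfold modR
        split_ifs with h
        · exact hB1 ⟨a, h⟩
        · simp; positivity
      · refine lt_of_le_of_lt ((dist_pi_le_iff (by positivity)).mpr fun l =>
          (dist_pi_le_iff (by positivity)).mpr fun a => ?_) (half_lt_self hε)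
        rw [Real.dist_eq, abs_sub_comm]
        unfold modC
        split_ifs with h
        · exact hB2 l ⟨a, h⟩
        · simp; positivity
      · intro a ha
        exact extVec_supp _ _ _ _ (by simp [lpSupport, ha])
      · rw [dot_extVec, dot_extVec]
        exact hv
    have hss : lpSupport xstar ⊆ J := by
      intro a ha
      by_contra h
      simp [lpSupport, hsub a h] at ha
    exact (Finset.eq_of_subset_of_card_le hss (by rw [hJ, hsupp])).symm
  · rintro hpos rfl
    refine hpos.ne' ?_
    have hU : IsUnit (subCols (lpA c) (lpSupport xstar) hsupp) := by
      rw [← Matrix.mulVec_injective_iff_isUnit]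
      intro y y' hyy
      have h0 : extVec _ hsupp (y - y') = 0 := by
        refine kernel_zero r c cbar xstar hopt huniq _ ?_ ?_
        · rw [mulVec_extVec, mulVec_sub, sub_eq_zero]; exact hyy
        · intro a ha
          exact extVec_supp _ _ _ _ (by simp [lpSupport, ha])
      ext j
      have := extVec_apply _ hsupp (y - y') j
      rw [h0] at this
      simp at this
      linarith
    have hsol : (subCols (lpA c) (lpSupport xstar) hsupp)⁻¹ *ᵥ lpb cbar
        = subVec xstar (lpSupport xstar) hsupp := by
      have h1 : lpb cbar = subCols (lpA c) (lpSupport xstar) hsupp *ᵥ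
          subVec xstar (lpSupport xstar) hsupp := by
        rw [← mulVec_extVec, extVec_surj, hopt.1.2]
        intro a ha
        simpa [lpSupport] using ha
      rw [h1, mulVec_mulVec,
        Matrix.nonsing_inv_mul _ ((Matrix.isUnit_iff_isUnit_det _).mp hU), one_mulVec]
    have hF : BasisFeasible (lpA c) (lpb cbar) (lpSupport xstar) hsupp :=
      ⟨hU, fun i => by rw [hsol]; exact hopt.1.1 _⟩
    have hm : modC c (fun l (a : Fin K₀) => c l (Fin.castLE hK₀ a)) = c := by
      ext l a
      unfold modC
      split_ifs <;> rfl
    rw [← nonpos_iff_eq_zero]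
    refine sInf_le ⟨fun a => r (Fin.castLE hK₀ a), fun l a => c l (Fin.castLE hK₀ a), ?_, ?_,
      le_rfl, by simp⟩
    · rw [hm]; exact hF
    · rw [hm]; exact hF


end
end

section
/- Under Assumption 1, the optimal support infeasibility gap is strictly positive: Δ_0² > 0. -/
open Matrix
open scoped ENNReal NNReal

noncomputable section

/-- Multiplying a vector supported on `J` by `A` only involves the columns in `J`. -/
theorem subCols_mulVec_subVec {K L : ℕ} (A : Matrix (Fin (L + 1)) (Fin (K + L)) ℝ)
    (J : Finset (Fin (K + L))) (hJ : J.card = L + 1) (w : Fin (K + L) → ℝ)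
    (hw : ∀ i, i ∉ J → w i = 0) : A *ᵥ w = subCols A J hJ *ᵥ subVec w J hJ := by
  funext k
  simp only [Matrix.mulVec, dotProduct, subCols, subVec, Matrix.of_apply]
  refine Eq.trans ?_ (Equiv.sum_comp (J.orderIsoOfFin hJ).toEquiv
    (fun i : J => A k (i : Fin (K + L)) * w (i : Fin (K + L)))).symm
  rw [Finset.sum_coe_sort J (fun i => A k i * w i)]
  symm
  apply Finset.sum_subset (Finset.subset_univ _)
  intro i _ hi
  rw [hw i hi, mul_zero]

theorem mem_lpSupport_iff {n : ℕ} (x : Fin n → ℝ) (i : Fin n) : i ∈ lpSupport x ↔ x i ≠ 0 := by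
  simp [lpSupport]

/-- A direction in the kernel of `A`, supported on the support of the unique optimum, vanishes. -/
theorem dir_eq_zero {K L : ℕ} (r : Fin K → ℝ) (c : Fin L → Fin K → ℝ) (cbar : Fin L → ℝ)
    (x w : Fin (K + L) → ℝ) (hopt : IsOptimal r c cbar x)
    (huniq : ∀ y, IsOptimal r c cbar y → y = x)
    (hw : ∀ i, x i = 0 → w i = 0) (hA : lpA c *ᵥ w = 0) : w = 0 := by
  have hev : ∀ᶠ t : ℝ in nhdsWithin 0 (Set.Ioi 0),
      ∀ i, 0 ≤ x i + t * w i ∧ 0 ≤ x i - t * w i := by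
    apply Filter.Eventually.filter_mono nhdsWithin_le_nhds
    rw [Filter.eventually_all]
    intro i
    by_cases hi : x i = 0
    · exact Filter.Eventually.of_forall fun t => by simp [hi, hw i hi]
    · have hpos : 0 < x i := lt_of_le_of_ne (hopt.1.1 i) (Ne.symm hi)
      have h1 : ∀ᶠ t : ℝ in nhds 0, 0 < x i + t * w i :=
        ContinuousAt.eventually_lt (by fun_prop) (by fun_prop) (by simpa using hpos)
      have h2 : ∀ᶠ t : ℝ in nhds 0, 0 < x i - t * w i :=
        ContinuousAt.eventually_lt (by fun_prop) (by fun_prop) (by simpa using hpos)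
      filter_upwards [h1, h2] with t a b
      exact ⟨a.le, b.le⟩
  obtain ⟨t, ht, ht0⟩ := (hev.and self_mem_nhdsWithin).exists
  have ht0 : 0 < t := ht0
  have f1 : IsFeasible c cbar (x + t • w) :=
    ⟨fun i => by simpa using (ht i).1, by
      rw [Matrix.mulVec_add, Matrix.mulVec_smul, hA, hopt.1.2]; simp⟩
  have f2 : IsFeasible c cbar (x - t • w) :=
    ⟨fun i => by simpa using (ht i).2, by
      rw [Matrix.mulVec_sub, Matrix.mulVec_smul, hA, hopt.1.2]; simp⟩
  have g1 := hopt.2 _ f1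
  have g2 := hopt.2 _ f2
  rw [dotProduct_add] at g1
  rw [dotProduct_sub] at g2
  have o1 : IsOptimal r c cbar (x + t • w) := by
    refine ⟨f1, fun y hy => ?_⟩
    have := hopt.2 y hy
    rw [dotProduct_add]
    linarith
  have h := huniq _ o1
  funext i
  have hi := congrFun h i
  simp only [Pi.add_apply, Pi.smul_apply, smul_eq_mul] at hi
  have : t * w i = 0 := by linarith
  simpa [ht0.ne'] using this

theorem isUnit_optimal_basis {K L : ℕ} (r : Fin K → ℝ) (c : Fin L → Fin K → ℝ)
    (cbar : Fin L → ℝ) (x : Fin (K + L) → ℝ) (hopt : IsOptimal r c cbar x)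
    (huniq : ∀ y, IsOptimal r c cbar y → y = x) (hs : (lpSupport x).card = L + 1) :
    IsUnit (subCols (lpA c) (lpSupport x) hs) := by
  rw [← Matrix.mulVec_injective_iff_isUnit]
  rw [← Matrix.coe_mulVecLin, ← LinearMap.ker_eq_bot, LinearMap.ker_eq_bot']
  intro v hv
  rw [Matrix.mulVecLin_apply] at hv
  let w : Fin (K + L) → ℝ := fun i =>
    if h : i ∈ lpSupport x then v (((lpSupport x).orderIsoOfFin hs).symm ⟨i, h⟩) else 0
  have hwv : subVec w (lpSupport x) hs = v := by
    funext j
    have hm := ((lpSupport x).orderIsoOfFin hs j).2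
    simp only [subVec, w]
    rw [dif_pos hm]
    exact congrArg v (((lpSupport x).orderIsoOfFin hs).symm_apply_apply j)
  have hoff : ∀ i, i ∉ lpSupport x → w i = 0 := fun i hi => by simp [w, hi]
  have h0 : w = 0 := by
    apply dir_eq_zero r c cbar x w hopt huniq
    · intro i hi
      exact hoff i (by simp [mem_lpSupport_iff, hi])
    · rw [subCols_mulVec_subVec _ _ hs w hoff, hwv, hv]
  rw [← hwv, h0]
  rfl

theorem basic_solution_eq {K L : ℕ} (r : Fin K → ℝ) (c : Fin L → Fin K → ℝ)
    (cbar : Fin L → ℝ) (x : Fin (K + L) → ℝ) (hopt : IsOptimal r c cbar x)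
    (hs : (lpSupport x).card = L + 1)
    (hu : IsUnit (subCols (lpA c) (lpSupport x) hs)) :
    (subCols (lpA c) (lpSupport x) hs)⁻¹ *ᵥ lpb cbar = subVec x (lpSupport x) hs := by
  have h := subCols_mulVec_subVec (lpA c) (lpSupport x) hs x
    (fun i hi => by simpa [mem_lpSupport_iff] using hi)
  rw [← hopt.1.2, h, Matrix.mulVec_mulVec,
    Matrix.nonsing_inv_mul _ ((Matrix.isUnit_iff_isUnit_det _).1 hu), Matrix.one_mulVec]

theorem continuous_subCols_modC {K L K₀ : ℕ} (c : Fin L → Fin K → ℝ)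
    (J : Finset (Fin (K + L))) (hJ : J.card = L + 1) :
    Continuous fun ct : Fin L → Fin K₀ → ℝ => subCols (lpA (modC c ct)) J hJ := by
  apply continuous_matrix
  intro i j
  simp only [subCols, lpA, modC, Matrix.of_apply]
  split_ifs <;> fun_prop

/-- Under Assumption 1, the optimal support infeasibility gap is strictly positive:
`Δ₀² > 0`. -/
theorem gapZero_pos
    (K L K₀ : ℕ) (hK : 0 < K) (hL : 0 < L) (hK₀pos : 0 < K₀) (hK₀ : K₀ ≤ K)
    (σr σc : ℝ) (hσr : 0 < σr) (hσc : 0 < σc)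
    (r : Fin K → ℝ) (c : Fin L → Fin K → ℝ) (cbar : Fin L → ℝ)
    (xstar : Fin (K + L) → ℝ)
    (hopt : IsOptimal r c cbar xstar)
    (huniq : ∀ y, IsOptimal r c cbar y → y = xstar)
    (hsupp : (lpSupport xstar).card = L + 1) :
    0 < gapZero K₀ hK₀ σc c cbar (lpSupport xstar) hsupp := by
  set J := lpSupport xstar with hJ
  let c0 : Fin L → Fin K₀ → ℝ := fun l a => c l (Fin.castLE hK₀ a)
  have hc0 : modC c c0 = c := by
    funext l a
    simp only [modC, c0]
    split_ifs <;> rfl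
  have hu := isUnit_optimal_basis r c cbar xstar hopt huniq hsupp
  have hsol := basic_solution_eq r c cbar xstar hopt hsupp hu
  have hcont := continuous_subCols_modC (K₀ := K₀) c J hsupp
  have hdet : (subCols (lpA (modC c c0)) J hsupp).det ≠ 0 := by
    rw [hc0]
    exact ((Matrix.isUnit_iff_isUnit_det _).1 hu).ne_zero
  have e1 : ∀ᶠ ct in nhds c0, (subCols (lpA (modC c ct)) J hsupp).det ≠ 0 :=
    hcont.matrix_det.continuousAt.eventually_ne hdet
  have hinv : ContinuousAt (fun ct : Fin L → Fin K₀ → ℝ =>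
      (subCols (lpA (modC c ct)) J hsupp)⁻¹ *ᵥ lpb cbar) c0 := by
    have h1 : ContinuousAt (fun ct : Fin L → Fin K₀ → ℝ =>
        ((subCols (lpA (modC c ct)) J hsupp).det)⁻¹ •
          ((subCols (lpA (modC c ct)) J hsupp).adjugate *ᵥ lpb cbar)) c0 :=
      (hcont.matrix_det.continuousAt.inv₀ hdet).smul
        (hcont.matrix_adjugate.matrix_mulVec continuous_const).continuousAt
    refine h1.congr (Filter.Eventually.of_forall fun ct => ?_)
    simp only [Matrix.inv_def, Ring.inverse_eq_inv', Matrix.smul_mulVec]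
  have e2 : ∀ᶠ ct in nhds c0,
      ∀ i, 0 < ((subCols (lpA (modC c ct)) J hsupp)⁻¹ *ᵥ lpb cbar) i := by
    rw [Filter.eventually_all]
    intro i
    refine ContinuousAt.eventually_lt continuousAt_const
      ((continuous_apply i).continuousAt.comp hinv) ?_
    rw [hc0, hsol]
    have hm := ((lpSupport xstar).orderIsoOfFin hsupp i).2
    exact lt_of_le_of_ne (hopt.1.1 _) (Ne.symm ((mem_lpSupport_iff xstar _).1 hm))
  obtain ⟨ε, hε, hball⟩ := Metric.eventually_nhds_iff.1 (e1.and e2)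
  have hδ : 0 < (σc ^ 2)⁻¹ * ε ^ 2 := by positivity
  refine lt_of_lt_of_le (ENNReal.ofReal_pos.2 hδ) (le_sInf ?_)
  rintro y ⟨ct, hbad, rfl⟩
  apply ENNReal.ofReal_le_ofReal
  apply mul_le_mul_of_nonneg_left _ (by positivity)
  by_contra! hlt
  have hd : dist ct c0 < ε := by
    rw [dist_pi_lt_iff hε]
    intro l
    rw [dist_pi_lt_iff hε]
    intro a
    have h1 : (c l (Fin.castLE hK₀ a) - ct l a) ^ 2 ≤
        ∑ l : Fin L, ∑ a : Fin K₀, (c l (Fin.castLE hK₀ a) - ct l a) ^ 2 :=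
      (Finset.single_le_sum (f := fun a : Fin K₀ => (c l (Fin.castLE hK₀ a) - ct l a) ^ 2)
        (fun _ _ => sq_nonneg _) (Finset.mem_univ a)).trans
      (Finset.single_le_sum
        (f := fun l : Fin L => ∑ a : Fin K₀, (c l (Fin.castLE hK₀ a) - ct l a) ^ 2)
        (fun _ _ => Finset.sum_nonneg fun _ _ => sq_nonneg _) (Finset.mem_univ l))
    rw [dist_comm, Real.dist_eq]
    exact abs_lt_of_sq_lt_sq (h1.trans_lt hlt) hε.le
  obtain ⟨hd1, hd2⟩ := hball hd
  rcases hbad with h | ⟨i, hi⟩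
  · exact h ((Matrix.isUnit_iff_isUnit_det _).2 (isUnit_iff_ne_zero.2 hd1))
  · exact absurd hi (not_lt.2 (hd2 i).le)

end
end

section
/- Assume Assumption 1. Fix an integer n ≥ 1, and on a product probability space let r̂_a ∼ N(r_a, σ_r²/n) for a ∈ [K_0] and ĉ_{l,a} ∼ N(c_{l,a}, σ_c²/n) for (l,a) ∈ [L]×[K_0] be mutually independent Gaussian random variables; let Â be obtained from A by replacing c_{l,a} by ĉ_{l,a} for all a ∈ [K_0], l ∈ [L]. Then the probability that Â_{I*} is singular, or Â_{I*} is invertible but some coordinate of Â_{I*}^{-1} b is negative, is at most 3^{L(L+1)/2} · exp(−n Δ_0²/3). (This is the bound on the event E_{k,0} in the proof of Theorem 1.) -/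
open Matrix
open scoped ENNReal NNReal

noncomputable section

/-- `exp(−t)` for an extended nonnegative real `t`, with the convention `exp(−∞) = 0`. -/
def expNeg (t : ℝ≥0∞) : ℝ≥0∞ :=
  if t = ⊤ then 0 else ENNReal.ofReal (Real.exp (-t.toReal))

open MeasureTheory ProbabilityTheory in
/-- The joint law of the mutually independent empirical means
`r̂_a ∼ N(r_a, σ_r²/n)` (`a ∈ [K₀]`) and `ĉ_{l,a} ∼ N(c_{l,a}, σ_c²/n)`
(`(l,a) ∈ [L]×[K₀]`), as a product Gaussian measure. -/
def empMeasure {K L : ℕ} (K₀ : ℕ) (hK₀ : K₀ ≤ K) (σr σc : ℝ) (n : ℕ)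
    (r : Fin K → ℝ) (c : Fin L → Fin K → ℝ) :
    Measure ((Fin K₀ ⊕ Fin L × Fin K₀) → ℝ) :=
  Measure.pi fun idx =>
    match idx with
    | Sum.inl a => gaussianReal (r (Fin.castLE hK₀ a)) (Real.toNNReal (σr ^ 2 / n))
    | Sum.inr (l, a) => gaussianReal (c l (Fin.castLE hK₀ a)) (Real.toNNReal (σc ^ 2 / n))

open MeasureTheory ProbabilityTheory in
lemma aux_gauss (m : ℝ) (v : ℝ≥0) (hv : v ≠ 0) :
    ∫⁻ x, ENNReal.ofReal (Real.exp ((x - m) ^ 2 / v / 3)) ∂(gaussianReal m v)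
      = ENNReal.ofReal (Real.sqrt 3) := by
  have hv0 : (0 : ℝ) < v := by positivity
  rw [gaussianReal_of_var_ne_zero m hv,
    lintegral_withDensity_eq_lintegral_mul _ (measurable_gaussianPDF m v) (by fun_prop)]
  have h3 : (3 * v : ℝ≥0) ≠ 0 := by positivity
  have key : ∀ x, (gaussianPDF m v * fun x => ENNReal.ofReal (Real.exp ((x - m) ^ 2 / v / 3))) x
      = ENNReal.ofReal (Real.sqrt 3) * ENNReal.ofReal (gaussianPDFReal m (3 * v) x) := by
    intro x
    simp only [Pi.mul_apply, gaussianPDF]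
    rw [← ENNReal.ofReal_mul (gaussianPDFReal_nonneg _ _ _), ← ENNReal.ofReal_mul (by positivity)]
    congr 1
    simp only [gaussianPDFReal]
    rw [mul_assoc, ← Real.exp_add]
    have e1 : -(x - m) ^ 2 / (2 * (v : ℝ)) + (x - m) ^ 2 / v / 3
        = -(x - m) ^ 2 / (2 * ((3 * v : ℝ≥0) : ℝ)) := by
      push_cast
      field_simp
      ring
    have e2 : Real.sqrt (2 * Real.pi * ((3 * v : ℝ≥0) : ℝ))
        = Real.sqrt 3 * Real.sqrt (2 * Real.pi * v) := by
      rw [← Real.sqrt_mul (by norm_num)]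
      push_cast
      congr 1
      ring
    have e3 : Real.sqrt 3 ≠ 0 := by positivity
    rw [e1, e2, mul_inv, ← mul_assoc, ← mul_assoc, mul_inv_cancel₀ e3, one_mul]
  simp_rw [key]
  rw [lintegral_const_mul' _ _ ENNReal.ofReal_ne_top, lintegral_gaussianPDFReal_eq_one m h3, mul_one]

open MeasureTheory ProbabilityTheory in
lemma aux_chernoff {ι : Type*} [Fintype ι] (m : ι → ℝ) (v : ι → ℝ≥0) (hv : ∀ i, v i ≠ 0)
    (s : Finset ι) (t : ℝ) :
    Measure.pi (fun i => gaussianReal (m i) (v i))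
      {ω | t ≤ ∑ i ∈ s, (ω i - m i) ^ 2 / v i}
      ≤ ENNReal.ofReal (Real.sqrt 3) ^ s.card * ENNReal.ofReal (Real.exp (-(t / 3))) := by
  have hind : iIndepFun (fun i (ω : ι → ℝ) =>
      ENNReal.ofReal (Real.exp ((ω i - m i) ^ 2 / v i / 3)))
      (Measure.pi (fun i => gaussianReal (m i) (v i))) :=
    iIndepFun_pi (μ := fun i => gaussianReal (m i) (v i))
      (X := fun i x => ENNReal.ofReal (Real.exp ((x - m i) ^ 2 / v i / 3)))
      (fun i => by fun_prop)
  have hint := lintegral_prod_eq_prod_lintegral_of_indepFun s _ hind (fun i => by fun_prop)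
  have hone : ∀ i, ∫⁻ ω : ι → ℝ, ENNReal.ofReal (Real.exp ((ω i - m i) ^ 2 / v i / 3))
      ∂(Measure.pi (fun i => gaussianReal (m i) (v i))) = ENNReal.ofReal (Real.sqrt 3) := by
    intro i
    rw [← aux_gauss (m i) (v i) (hv i)]
    exact (measurePreserving_eval (fun i => gaussianReal (m i) (v i)) i).lintegral_comp
      (f := fun x => ENNReal.ofReal (Real.exp ((x - m i) ^ 2 / v i / 3))) (by fun_prop)
  simp only [hone, Finset.prod_const] at hint
  rw [← hint, ← lintegral_mul_const' _ _ ENNReal.ofReal_ne_top]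
  apply meas_le_lintegral₀
  · exact ((Finset.measurable_prod _ (fun i _ => by fun_prop)).mul_const _).aemeasurable
  · intro ω hω
    simp only [Set.mem_ofPred_eq] at hω
    rw [← ENNReal.ofReal_prod_of_nonneg (fun i _ => (Real.exp_pos _).le), ← Real.exp_sum,
      ← ENNReal.ofReal_mul (Real.exp_pos _).le, ← Real.exp_add, ← Finset.sum_div,
      ENNReal.one_le_ofReal]
    apply Real.one_le_exp
    linarith

lemma aux_card {K L K₀ : ℕ} (hK₀ : K₀ ≤ K) (I : Finset (Fin (K + L))) (hI : I.card = L + 1) :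
    (Finset.univ.filter fun a : Fin K₀ => Fin.castLE (hK₀.trans (Nat.le_add_right K L)) a ∈ I).card
      ≤ L + 1 := by
  rw [← hI]
  apply Finset.card_le_card_of_injOn (fun a => Fin.castLE (hK₀.trans (Nat.le_add_right K L)) a)
  · intro a ha
    simpa using ha
  · exact (Fin.castLE_injective _).injOn

/-- Off-support costs do not matter. -/
lemma aux_subCols {K L K₀ : ℕ} (hK₀ : K₀ ≤ K) (c : Fin L → Fin K → ℝ) (ct : Fin L → Fin K₀ → ℝ)
    (I : Finset (Fin (K + L))) (hI : I.card = L + 1) :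
    subCols (lpA (modC c fun l a =>
      if Fin.castLE (hK₀.trans (Nat.le_add_right K L)) a ∈ I then ct l a
        else c l (Fin.castLE hK₀ a))) I hI = subCols (lpA (modC c ct)) I hI := by
  ext i j
  simp only [subCols, lpA, modC, Matrix.of_apply]
  have hmem := (I.orderIsoOfFin hI j).2
  generalize ((I.orderIsoOfFin hI j : I) : Fin (K + L)) = q at hmem
  split_ifs with h1 h2 h3 h4 <;> try rfl
  exact absurd hmem h4

/-- **Bound on the event `E_{k,0}`** in the proof of Theorem 1: under Assumption 1, the
probability that the empirical matrix `Â_{I*}` is singular, or is invertible but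
`Â_{I*}^{-1} b` has a negative coordinate, is at most `3^{L(L+1)/2} exp(−n Δ₀²/3)`. -/
theorem prob_optimal_basis_empirically_infeasible
    (K L K₀ : ℕ) (hK : 0 < K) (hL : 0 < L) (hK₀pos : 0 < K₀) (hK₀ : K₀ ≤ K)
    (σr σc : ℝ) (hσr : 0 < σr) (hσc : 0 < σc)
    (r : Fin K → ℝ) (c : Fin L → Fin K → ℝ) (cbar : Fin L → ℝ)
    (xstar : Fin (K + L) → ℝ)
    (hopt : IsOptimal r c cbar xstar)
    (huniq : ∀ y, IsOptimal r c cbar y → y = xstar)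
    (hsupp : (lpSupport xstar).card = L + 1)
    (n : ℕ) (hn : 1 ≤ n) :
    empMeasure K₀ hK₀ σr σc n r c
        {ω | ¬ IsUnit (subCols (lpA (modC c fun l a => ω (Sum.inr (l, a))))
                (lpSupport xstar) hsupp) ∨
          ∃ i, ((subCols (lpA (modC c fun l a => ω (Sum.inr (l, a))))
                (lpSupport xstar) hsupp)⁻¹ *ᵥ lpb cbar) i < 0}
      ≤ (3 : ℝ≥0∞) ^ (L * (L + 1) / 2)
          * expNeg ((n : ℝ≥0∞) * gapZero K₀ hK₀ σc c cbar (lpSupport xstar) hsupp / 3) := by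
  classical
  set I := lpSupport xstar with hIdef
  set g := gapZero K₀ hK₀ σc c cbar I hsupp with hg
  set T := Finset.univ.filter fun a : Fin K₀ =>
    Fin.castLE (hK₀.trans (Nat.le_add_right K L)) a ∈ I with hT
  have hn0 : (0 : ℝ) < n := by exact_mod_cast hn
  have hbad : ∀ ct : Fin L → Fin K₀ → ℝ,
      (¬ IsUnit (subCols (lpA (modC c ct)) I hsupp) ∨
        ∃ i, ((subCols (lpA (modC c ct)) I hsupp)⁻¹ *ᵥ lpb cbar) i < 0) →
      g ≤ ENNReal.ofReal ((σc ^ 2)⁻¹ * ∑ l : Fin L, ∑ a ∈ T,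
        (ct l a - c l (Fin.castLE hK₀ a)) ^ 2) := by
    intro ct hct
    apply sInf_le
    refine ⟨fun l a => if Fin.castLE (hK₀.trans (Nat.le_add_right K L)) a ∈ I then ct l a
        else c l (Fin.castLE hK₀ a), ?_, ?_⟩
    · rw [aux_subCols]
      exact hct
    · congr 2
      refine Finset.sum_congr rfl fun l _ => ?_
      rw [hT, Finset.sum_filter]
      refine Finset.sum_congr rfl fun a _ => ?_
      by_cases hmem : Fin.castLE (hK₀.trans (Nat.le_add_right K L)) a ∈ I
      · simp only [if_pos hmem]
        ring
      · simp only [if_neg hmem]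
        ring
  by_cases htop : g = ⊤
  · have hempty : {ω : (Fin K₀ ⊕ Fin L × Fin K₀) → ℝ |
        ¬ IsUnit (subCols (lpA (modC c fun l a => ω (Sum.inr (l, a)))) I hsupp) ∨
          ∃ i, ((subCols (lpA (modC c fun l a => ω (Sum.inr (l, a)))) I hsupp)⁻¹
            *ᵥ lpb cbar) i < 0} = ∅ := by
      rw [Set.eq_empty_iff_forall_notMem]
      intro ω hω
      have := hbad _ hω
      rw [htop] at this
      exact ENNReal.ofReal_ne_top (top_le_iff.mp this)
    rw [hempty, MeasureTheory.measure_empty]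
    exact zero_le
  · set m : (Fin K₀ ⊕ Fin L × Fin K₀) → ℝ :=
      Sum.elim (fun a => r (Fin.castLE hK₀ a)) (fun p => c p.1 (Fin.castLE hK₀ p.2)) with hm
    set v : (Fin K₀ ⊕ Fin L × Fin K₀) → ℝ≥0 :=
      Sum.elim (fun _ => Real.toNNReal (σr ^ 2 / n)) (fun _ => Real.toNNReal (σc ^ 2 / n)) with hv
    have hmeas : empMeasure K₀ hK₀ σr σc n r c
        = MeasureTheory.Measure.pi (fun i => ProbabilityTheory.gaussianReal (m i) (v i)) := by
      unfold empMeasure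
      congr 1
      funext i
      rcases i with a | ⟨l, a⟩ <;> rfl
    have hvpos : ∀ i, v i ≠ 0 := by
      intro i
      rcases i with a | p
      · simp only [hv, Sum.elim_inl]
        exact (Real.toNNReal_pos.mpr (by positivity)).ne'
      · simp only [hv, Sum.elim_inr]
        exact (Real.toNNReal_pos.mpr (by positivity)).ne'
    set s : Finset (Fin K₀ ⊕ Fin L × Fin K₀) :=
      ((Finset.univ : Finset (Fin L)) ×ˢ T).map Function.Embedding.inr with hs
    have hscard : s.card ≤ L * (L + 1) := by
      rw [hs, Finset.card_map, Finset.card_product, Finset.card_univ, Fintype.card_fin]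
      exact Nat.mul_le_mul_left _ (aux_card hK₀ I hsupp)
    have hsum : ∀ ω : (Fin K₀ ⊕ Fin L × Fin K₀) → ℝ, ∑ i ∈ s, (ω i - m i) ^ 2 / v i
        = n * ((σc ^ 2)⁻¹ * ∑ l : Fin L, ∑ a ∈ T,
          (ω (Sum.inr (l, a)) - c l (Fin.castLE hK₀ a)) ^ 2) := by
      intro ω
      rw [hs, Finset.sum_map, Finset.sum_product, Finset.mul_sum, Finset.mul_sum]
      refine Finset.sum_congr rfl fun l _ => ?_
      rw [Finset.mul_sum, Finset.mul_sum]
      refine Finset.sum_congr rfl fun a _ => ?_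
      simp only [hm, hv, Function.Embedding.inr_apply, Sum.elim_inr]
      rw [Real.coe_toNNReal _ (by positivity)]
      field_simp
    have hexp : expNeg ((n : ℝ≥0∞) * g / 3)
        = ENNReal.ofReal (Real.exp (-(n * g.toReal / 3))) := by
      have hne : (n : ℝ≥0∞) * g / 3 ≠ ⊤ :=
        ENNReal.div_ne_top (ENNReal.mul_ne_top (ENNReal.natCast_ne_top n) htop) (by norm_num)
      rw [expNeg, if_neg hne, ENNReal.toReal_div, ENNReal.toReal_mul]
      simp
    have hpow : ENNReal.ofReal (Real.sqrt 3) ^ s.card ≤ (3 : ℝ≥0∞) ^ (L * (L + 1) / 2) := by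
      have h1 : (1 : ℝ≥0∞) ≤ ENNReal.ofReal (Real.sqrt 3) := by
        rw [ENNReal.one_le_ofReal]
        exact Real.one_le_sqrt.mpr (by norm_num)
      have h2 : (3 : ℝ≥0∞) = ENNReal.ofReal (Real.sqrt 3) ^ 2 := by
        rw [← ENNReal.ofReal_pow (by positivity), Real.sq_sqrt (by norm_num)]
        simp
      rw [h2, ← pow_mul, Nat.mul_div_cancel' (Nat.even_mul_succ_self L).two_dvd]
      exact pow_le_pow_right₀ h1 hscard
    rw [hmeas, hexp]
    refine le_trans (MeasureTheory.measure_mono ?_)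
      ((aux_chernoff m v hvpos s (n * g.toReal)).trans (mul_le_mul_left hpow _))
    intro ω hω
    have h := hbad _ hω
    simp only [Set.mem_ofPred_eq]
    rw [hsum]
    refine mul_le_mul_of_nonneg_left ?_ hn0.le
    exact ENNReal.toReal_le_of_le_ofReal (by positivity) h

end
end

section
/- Assume Assumption 1 and fix an arm a ∈ [K+L] with Δ_a² < +∞. Fix an integer n ≥ 1, and on a product probability space let r̂_i ∼ N(r_i, σ_r²/n) for i ∈ [K_0] and ĉ_{l,i} ∼ N(c_{l,i}, σ_c²/n) for (l,i) ∈ [L]×[K_0] be mutually independent Gaussian random variables; let (μ̂, Â) be obtained from (μ, A) by replacing r_i by r̂_i and c_{l,i} by ĉ_{l,i} for all i ∈ [K_0], l ∈ [L]. Then the probability that there exists a basis J with a ∈ J such that Â_{I*} and Â_J are invertible, Â_{I*}^{-1} b ≥ 0, Â_J^{-1} b ≥ 0, and μ̂_J^T Â_J^{-1} b ≥ μ̂_{I*}^T Â_{I*}^{-1} b, is at most C(K+L−1, L) · 3^{(L+1)²} · exp(−n Δ_a²/3), where C(·,·) denotes the binomial coefficient. (This is the bound on the event E_{k,a} in the proof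 of Theorem 1.) -/
open Matrix
open scoped ENNReal NNReal

noncomputable section

section Helpers

open MeasureTheory ProbabilityTheory

/-- Exponential moment of a squared standardized Gaussian at `1/3`. -/
lemma gauss_exp_sq (m : ℝ) (v : ℝ≥0) (hv : v ≠ 0) :
    ∫⁻ x, ENNReal.ofReal (Real.exp ((x - m) ^ 2 / (3 * v))) ∂(gaussianReal m v)
      = ENNReal.ofReal (Real.sqrt 3) := by
  have hv' : (0 : ℝ) < v := by positivity
  rw [gaussianReal_of_var_ne_zero m hv,
    lintegral_withDensity_eq_lintegral_mul _ (measurable_gaussianPDF m v) (by fun_prop)]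
  have h : ∀ x, (gaussianPDF m v * fun x => ENNReal.ofReal (Real.exp ((x - m) ^ 2 / (3 * v)))) x
      = ENNReal.ofReal (Real.sqrt 3) * gaussianPDF m (3 * v) x := by
    intro x
    simp only [Pi.mul_apply, gaussianPDF, gaussianPDFReal]
    rw [← ENNReal.ofReal_mul (by positivity), ← ENNReal.ofReal_mul (by positivity)]
    congr 1
    rw [mul_assoc, ← Real.exp_add]
    have e1 : -(x - m) ^ 2 / (2 * (v : ℝ)) + (x - m) ^ 2 / (3 * v)
        = -(x - m) ^ 2 / (2 * ((3 * v : ℝ≥0) : ℝ)) := by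
      push_cast
      field_simp
      ring
    rw [e1, ← mul_assoc]
    congr 1
    push_cast
    rw [show 2 * Real.pi * (3 * (v : ℝ)) = 3 * (2 * Real.pi * v) by ring,
      Real.sqrt_mul (by norm_num : (0 : ℝ) ≤ 3) (2 * Real.pi * v)]
    have h3 : Real.sqrt 3 ≠ 0 := by positivity
    have h4 : Real.sqrt (2 * Real.pi * v) ≠ 0 := by positivity
    field_simp
  simp_rw [h]
  rw [lintegral_const_mul _ (measurable_gaussianPDF _ _),
    lintegral_gaussianPDF_eq_one _ (by simpa using hv), mul_one]

/-- Chernoff bound for a partial chi-square sum under a product Gaussian. -/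
lemma chi_tail {ι : Type*} [Fintype ι] [DecidableEq ι] (m : ι → ℝ) (v : ι → ℝ≥0)
    (hv : ∀ i, v i ≠ 0) (S : Finset ι) (N : ℕ) (hS : S.card ≤ 2 * N) (t : ℝ) :
    Measure.pi (fun i => gaussianReal (m i) (v i))
      {ω | t ≤ ∑ i ∈ S, (ω i - m i) ^ 2 / v i}
      ≤ (3 : ℝ≥0∞) ^ N * ENNReal.ofReal (Real.exp (-(t / 3))) := by
  set P := Measure.pi (fun i => gaussianReal (m i) (v i)) with hP
  let g : ι → ℝ → ℝ≥0∞ := fun i x =>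
    if i ∈ S then ENNReal.ofReal (Real.exp ((x - m i) ^ 2 / (3 * v i))) else 1
  have hg : ∀ i, Measurable (g i) := by
    intro i
    by_cases h : i ∈ S
    · simp only [g, h, if_true]; fun_prop
    · simp only [g, h, if_false]; fun_prop
  have hint : ∫⁻ ω, ∏ i, g i (ω i) ∂P = ENNReal.ofReal (Real.sqrt 3) ^ S.card := by
    rw [hP, lintegral_prod_eq_prod_lintegral_of_indepFun Finset.univ
      (fun i (ω : ι → ℝ) => g i (ω i)) (iIndepFun_pi fun i => (hg i).aemeasurable)
      (fun i => (hg i).comp (measurable_pi_apply i))]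
    have hev : ∀ i, ∫⁻ ω, g i (ω i) ∂(Measure.pi fun i => gaussianReal (m i) (v i))
        = ∫⁻ x, g i x ∂(gaussianReal (m i) (v i)) := fun i =>
      (measurePreserving_eval (fun i => gaussianReal (m i) (v i)) i).lintegral_comp (hg i)
    have : ∀ i, ∫⁻ x, g i x ∂(gaussianReal (m i) (v i))
        = if i ∈ S then ENNReal.ofReal (Real.sqrt 3) else 1 := by
      intro i
      by_cases h : i ∈ S
      · simp only [g, h, if_true]; exact gauss_exp_sq _ _ (hv i)
      · simp only [g, h, if_false]; simp
    simp_rw [hev, this]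
    rw [Finset.prod_ite]
    simp
  have hle : ENNReal.ofReal (Real.sqrt 3) ^ S.card ≤ (3 : ℝ≥0∞) ^ N := by
    have h1 : (1 : ℝ≥0∞) ≤ ENNReal.ofReal (Real.sqrt 3) := by
      rw [ENNReal.one_le_ofReal, Real.one_le_sqrt]; norm_num
    refine (pow_le_pow_right₀ h1 hS).trans ?_
    rw [pow_mul, ← ENNReal.ofReal_pow (by positivity), Real.sq_sqrt (by norm_num)]
    simp
  have hsub : {ω : ι → ℝ | t ≤ ∑ i ∈ S, (ω i - m i) ^ 2 / v i}
      ⊆ {ω | ENNReal.ofReal (Real.exp (t / 3)) ≤ ∏ i, g i (ω i)} := by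
    intro ω hω
    simp only [Set.mem_ofPred_eq] at hω ⊢
    have : ∏ i, g i (ω i)
        = ENNReal.ofReal (Real.exp ((∑ i ∈ S, (ω i - m i) ^ 2 / v i) / 3)) := by
      simp only [g]
      rw [Finset.prod_ite]
      simp only [Finset.prod_const_one, mul_one, Finset.filter_mem_eq_inter, Finset.univ_inter]
      rw [← ENNReal.ofReal_prod_of_nonneg (fun _ _ => (Real.exp_pos _).le), ← Real.exp_sum,
        Finset.sum_div]
      congr 2
      refine Finset.sum_congr rfl fun i _ => ?_
      rw [div_div, mul_comm]
    rw [this]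
    gcongr
  refine (measure_mono hsub).trans ?_
  refine (meas_ge_le_lintegral_div ?_ ?_ ?_).trans ?_
  · exact (Finset.measurable_fun_prod _ fun i _ => (hg i).comp (measurable_pi_apply i)).aemeasurable
  · simp [Real.exp_pos]
  · simp
  · rw [hint, div_eq_mul_inv, ← ENNReal.ofReal_inv_of_pos (Real.exp_pos _), ← Real.exp_neg]
    gcongr

/-- The number of bases containing a given arm. -/
lemma card_bases {M L : ℕ} (a : Fin M) :
    ((Finset.univ : Finset (Finset (Fin M))).filter
      (fun J => J.card = L + 1 ∧ a ∈ J)).card ≤ Nat.choose (M - 1) L := by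
  have h : (Finset.powersetCard L (Finset.univ.erase a)).card = Nat.choose (M - 1) L := by
    simp [Finset.card_powersetCard]
  rw [← h]
  refine Finset.card_le_card_of_injOn (fun J => J.erase a) ?_ ?_
  · intro J hJ
    simp only [Finset.coe_filter, Finset.mem_univ, true_and, Set.mem_ofPred_eq] at hJ
    simp only [Finset.mem_coe, Finset.mem_powersetCard]
    refine ⟨Finset.erase_subset_erase _ (Finset.subset_univ _), ?_⟩
    rw [Finset.card_erase_of_mem hJ.2, hJ.1]; rfl
  · intro J hJ J' hJ' hE
    simp only [Finset.coe_filter, Finset.mem_univ, true_and, Set.mem_ofPred_eq] at hJ hJ'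
    have := congrArg (insert a) hE
    simpa [Finset.insert_erase hJ.2, Finset.insert_erase hJ'.2] using this

/-- Arm index of a coordinate. -/
def coordArm {L K₀ : ℕ} : Fin K₀ ⊕ Fin L × Fin K₀ → Fin K₀
  | Sum.inl i => i
  | Sum.inr p => p.2

/-- Coordinates relevant for a set of columns. -/
def relCoords {K L K₀ : ℕ} (hK₀ : K₀ ≤ K) (U : Finset (Fin (K + L))) :
    Finset (Fin K₀ ⊕ Fin L × Fin K₀) :=
  Finset.univ.filter fun idx => Fin.castAdd L (Fin.castLE hK₀ (coordArm idx)) ∈ U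

lemma card_relCoords {K L K₀ : ℕ} (hK₀ : K₀ ≤ K) (U : Finset (Fin (K + L))) :
    (relCoords hK₀ U).card ≤ U.card * (L + 1) := by
  have h : (U ×ˢ (Finset.univ : Finset (Fin (L + 1)))).card = U.card * (L + 1) := by
    simp [Finset.card_product]
  rw [← h]
  let e : Fin K₀ ⊕ Fin L × Fin K₀ → Fin (L + 1)
    | Sum.inl _ => Fin.last L
    | Sum.inr p => Fin.castSucc p.1
  refine Finset.card_le_card_of_injOn
    (fun idx => (Fin.castAdd L (Fin.castLE hK₀ (coordArm idx)), e idx)) ?_ ?_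
  · intro idx h
    simpa [relCoords] using h
  · rintro (i | ⟨l, i⟩) _ (j | ⟨l', j⟩) _ hE
    · simpa [coordArm, e] using hE
    · simp [coordArm, e, Fin.ext_iff] at hE; omega
    · simp [coordArm, e, Fin.ext_iff] at hE; omega
    · simp [coordArm, e, Fin.ext_iff] at hE
      simp [Fin.ext_iff]; omega

lemma subCols_congr {K L : ℕ} (A B : Matrix (Fin (L + 1)) (Fin (K + L)) ℝ)
    (J : Finset (Fin (K + L))) (hJ : J.card = L + 1)
    (h : ∀ i, ∀ j ∈ J, A i j = B i j) : subCols A J hJ = subCols B J hJ := by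
  ext i j
  exact h i _ (Subtype.coe_prop _)

lemma subVec_congr {K L : ℕ} (u w : Fin (K + L) → ℝ)
    (J : Finset (Fin (K + L))) (hJ : J.card = L + 1)
    (h : ∀ j ∈ J, u j = w j) : subVec u J hJ = subVec w J hJ := by
  ext j
  exact h _ (Subtype.coe_prop _)

/-- On the event for `J`, the basis gap is bounded by the weighted deviation on the relevant
coordinates only. -/
lemma gapBasis_le {K L K₀ : ℕ} (hK₀ : K₀ ≤ K) (σr σc : ℝ) (r : Fin K → ℝ)
    (c : Fin L → Fin K → ℝ) (cbar : Fin L → ℝ) (I J : Finset (Fin (K + L)))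
    (hI : I.card = L + 1) (hJ : J.card = L + 1) (ω : Fin K₀ ⊕ Fin L × Fin K₀ → ℝ)
    (h1 : BasisFeasible (lpA (modC c fun l i => ω (Sum.inr (l, i)))) (lpb cbar) I hI)
    (h2 : BasisFeasible (lpA (modC c fun l i => ω (Sum.inr (l, i)))) (lpb cbar) J hJ)
    (h3 : basisValue (lpMu (modR r fun i => ω (Sum.inl i)))
              (lpA (modC c fun l i => ω (Sum.inr (l, i)))) (lpb cbar) I hI ≤
            basisValue (lpMu (modR r fun i => ω (Sum.inl i)))
              (lpA (modC c fun l i => ω (Sum.inr (l, i)))) (lpb cbar) J hJ) :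
    gapBasis K₀ hK₀ σr σc r c cbar I J hI hJ ≤
      ENNReal.ofReal (∑ idx ∈ relCoords hK₀ (I ∪ J),
        (ω idx - Sum.elim (fun i => r (Fin.castLE hK₀ i))
          (fun p => c p.1 (Fin.castLE hK₀ p.2)) idx) ^ 2 *
          Sum.elim (fun _ => (σr ^ 2)⁻¹) (fun _ => (σc ^ 2)⁻¹) idx) := by
  let rt : Fin K₀ → ℝ := fun i =>
    if Fin.castAdd L (Fin.castLE hK₀ i) ∈ I ∪ J then ω (Sum.inl i) else r (Fin.castLE hK₀ i)
  let ct : Fin L → Fin K₀ → ℝ := fun l i =>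
    if Fin.castAdd L (Fin.castLE hK₀ i) ∈ I ∪ J then ω (Sum.inr (l, i))
    else c l (Fin.castLE hK₀ i)
  have hA : ∀ i, ∀ j ∈ I ∪ J, lpA (modC c fun l i => ω (Sum.inr (l, i))) i j
      = lpA (modC c ct) i j := by
    intro i j hj
    simp only [lpA, Matrix.of_apply, modC]
    split_ifs with h h' h''
    · have : Fin.castAdd L (Fin.castLE hK₀ ⟨(j : ℕ), h''⟩) = j := by ext; simp
      simp only [ct, this, hj, if_true]
    all_goals rfl
  have hM : ∀ j ∈ I ∪ J, lpMu (L := L) (modR r fun i => ω (Sum.inl i)) j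
      = lpMu (modR r rt) j := by
    intro j hj
    simp only [lpMu, modR]
    split_ifs with h h'
    · have : Fin.castAdd L (Fin.castLE hK₀ ⟨(j : ℕ), h'⟩) = j := by ext; simp
      simp only [rt, this, hj, if_true]
    all_goals rfl
  have hAI := subCols_congr _ _ I hI fun i j hj => hA i j (Finset.mem_union_left _ hj)
  have hAJ := subCols_congr _ _ J hJ fun i j hj => hA i j (Finset.mem_union_right _ hj)
  have hMI := subVec_congr _ _ I hI fun j hj => hM j (Finset.mem_union_left _ hj)
  have hMJ := subVec_congr _ _ J hJ fun j hj => hM j (Finset.mem_union_right _ hj)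
  refine sInf_le ⟨rt, ct, ?_, ?_, ?_, ?_⟩
  · simpa only [BasisFeasible, hAI] using h1
  · simpa only [BasisFeasible, hAJ] using h2
  · simpa only [basisValue, hAI, hAJ, hMI, hMJ] using h3
  · congr 1
    rw [relCoords, Finset.sum_filter, Fintype.sum_sum_type, Fintype.sum_prod_type,
      Finset.mul_sum, Finset.mul_sum]
    congr 1
    · refine Finset.sum_congr rfl fun i _ => ?_
      by_cases h : Fin.castAdd L (Fin.castLE hK₀ i) ∈ I ∪ J
      · simp only [coordArm, Sum.elim_inl, rt, h, if_true]
        ring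
      · simp only [coordArm, Sum.elim_inl, rt, h, if_false]
        ring
    · refine Finset.sum_congr rfl fun l _ => ?_
      rw [Finset.mul_sum]
      refine Finset.sum_congr rfl fun i _ => ?_
      by_cases h : Fin.castAdd L (Fin.castLE hK₀ i) ∈ I ∪ J
      · simp only [coordArm, Sum.elim_inr, ct, h, if_true]
        ring
      · simp only [coordArm, Sum.elim_inr, ct, h, if_false]
        ring

end Helpers

/-- **Bound on the event `E_{k,a}`** in the proof of Theorem 1: under Assumption 1, for an arm
`a` with `Δ_a² < ∞`, the probability that some basis `J ∋ a` is feasible under the empirical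
means `(μ̂, Â)` and weakly overtakes `I*` in empirical value is at most
`C(K+L−1, L) · 3^{(L+1)²} · exp(−n Δ_a²/3)`. -/
theorem prob_overtaking_basis_containing_arm
    (K L K₀ : ℕ) (hK : 0 < K) (hL : 0 < L) (hK₀pos : 0 < K₀) (hK₀ : K₀ ≤ K)
    (σr σc : ℝ) (hσr : 0 < σr) (hσc : 0 < σc)
    (r : Fin K → ℝ) (c : Fin L → Fin K → ℝ) (cbar : Fin L → ℝ)
    (xstar : Fin (K + L) → ℝ)
    (hopt : IsOptimal r c cbar xstar)
    (huniq : ∀ y, IsOptimal r c cbar y → y = xstar)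
    (hsupp : (lpSupport xstar).card = L + 1)
    (a : Fin (K + L))
    (hfin : gapArm K₀ hK₀ σr σc r c cbar (lpSupport xstar) hsupp a < ⊤)
    (n : ℕ) (hn : 1 ≤ n) :
    empMeasure K₀ hK₀ σr σc n r c
        {ω | ∃ (J : Finset (Fin (K + L))) (hJ : J.card = L + 1), a ∈ J ∧
          BasisFeasible (lpA (modC c fun l i => ω (Sum.inr (l, i)))) (lpb cbar)
            (lpSupport xstar) hsupp ∧
          BasisFeasible (lpA (modC c fun l i => ω (Sum.inr (l, i)))) (lpb cbar) J hJ ∧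
          basisValue (lpMu (modR r fun i => ω (Sum.inl i)))
              (lpA (modC c fun l i => ω (Sum.inr (l, i)))) (lpb cbar)
              (lpSupport xstar) hsupp ≤
            basisValue (lpMu (modR r fun i => ω (Sum.inl i)))
              (lpA (modC c fun l i => ω (Sum.inr (l, i)))) (lpb cbar) J hJ}
      ≤ (Nat.choose (K + L - 1) L : ℝ≥0∞) * (3 : ℝ≥0∞) ^ ((L + 1) ^ 2)
          * expNeg ((n : ℝ≥0∞)
              * gapArm K₀ hK₀ σr σc r c cbar (lpSupport xstar) hsupp a / 3) := by
  classical
  set G := gapArm K₀ hK₀ σr σc r c cbar (lpSupport xstar) hsupp a with hG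
  set I := lpSupport xstar with hIdef
  have hn0 : (0 : ℝ) < n := by exact_mod_cast hn
  let m : Fin K₀ ⊕ Fin L × Fin K₀ → ℝ := Sum.elim (fun i => r (Fin.castLE hK₀ i))
          (fun p => c p.1 (Fin.castLE hK₀ p.2))
  let v : Fin K₀ ⊕ Fin L × Fin K₀ → ℝ≥0 := Sum.elim (fun _ => Real.toNNReal (σr ^ 2 / n))
          (fun _ => Real.toNNReal (σc ^ 2 / n))
  have hvr : 0 < σr ^ 2 / n := by positivity
  have hvc : 0 < σc ^ 2 / n := by positivity
  have hv : ∀ i, v i ≠ 0 := by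
    rintro (i | p)
    · simpa [v] using hvr
    · simpa [v] using hvc
  have hP : empMeasure K₀ hK₀ σr σc n r c
      = MeasureTheory.Measure.pi (fun i => ProbabilityTheory.gaussianReal (m i) (v i)) := by
    unfold empMeasure
    congr 1
    funext idx
    rcases idx with i | ⟨l, i⟩ <;> rfl
  rw [hP]
  set P := MeasureTheory.Measure.pi (fun i => ProbabilityTheory.gaussianReal (m i) (v i))
  let B := (Finset.univ : Finset (Finset (Fin (K + L)))).filter
      (fun J => J.card = L + 1 ∧ a ∈ J)
  let T : Finset (Fin (K + L)) → Set (Fin K₀ ⊕ Fin L × Fin K₀ → ℝ) := fun J =>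
    {ω | n * G.toReal ≤ ∑ i ∈ relCoords hK₀ (I ∪ J), (ω i - m i) ^ 2 / v i}
  have hexp : expNeg ((n : ℝ≥0∞) * G / 3)
      = ENNReal.ofReal (Real.exp (-(n * G.toReal / 3))) := by
    have : (n : ℝ≥0∞) * G / 3 ≠ ⊤ :=
      ENNReal.div_ne_top (ENNReal.mul_ne_top (by simp) hfin.ne) (by norm_num)
    rw [expNeg, if_neg this]
    simp [ENNReal.toReal_div, ENNReal.toReal_mul]
  have hT : ∀ J ∈ B, P (T J) ≤ (3 : ℝ≥0∞) ^ ((L + 1) ^ 2) *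
      ENNReal.ofReal (Real.exp (-(n * G.toReal / 3))) := by
    intro J hJ
    have hJ' : J.card = L + 1 := by simpa using (Finset.mem_filter.mp hJ).2.1
    refine chi_tail m v hv _ _ ?_ _
    refine (card_relCoords hK₀ (I ∪ J)).trans ?_
    have := Finset.card_union_le I J
    rw [hsupp, hJ'] at this
    calc (I ∪ J).card * (L + 1) ≤ (L + 1 + (L + 1)) * (L + 1) := Nat.mul_le_mul_right _ this
      _ = 2 * (L + 1) ^ 2 := by ring
  have hsub : {ω | ∃ (J : Finset (Fin (K + L))) (hJ : J.card = L + 1), a ∈ J ∧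
          BasisFeasible (lpA (modC c fun l i => ω (Sum.inr (l, i)))) (lpb cbar) I hsupp ∧
          BasisFeasible (lpA (modC c fun l i => ω (Sum.inr (l, i)))) (lpb cbar) J hJ ∧
          basisValue (lpMu (modR r fun i => ω (Sum.inl i)))
              (lpA (modC c fun l i => ω (Sum.inr (l, i)))) (lpb cbar) I hsupp ≤
            basisValue (lpMu (modR r fun i => ω (Sum.inl i)))
              (lpA (modC c fun l i => ω (Sum.inr (l, i)))) (lpb cbar) J hJ}
      ⊆ ⋃ J ∈ B, T J := by
    rintro ω ⟨J, hJ, haJ, h1, h2, h3⟩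
    simp only [Set.mem_iUnion]
    refine ⟨J, by simp [B, hJ, haJ], ?_⟩
    have hle : G ≤ gapBasis K₀ hK₀ σr σc r c cbar I J hsupp hJ := iInf_le_of_le J
      (iInf_le_of_le hJ (iInf_le_of_le haJ le_rfl))
    have h := hle.trans (gapBasis_le hK₀ σr σc r c cbar I J hsupp hJ ω h1 h2 h3)
    have h' := ENNReal.toReal_le_of_le_ofReal (Finset.sum_nonneg fun idx _ =>
      mul_nonneg (sq_nonneg _) (by rcases idx with i | p <;> simp <;> positivity)) h
    simp only [T, Set.mem_ofPred_eq]
    refine (mul_le_mul_of_nonneg_left h' hn0.le).trans (le_of_eq ?_)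
    rw [Finset.mul_sum]
    refine Finset.sum_congr rfl fun idx _ => ?_
    rcases idx with i | p
    · simp only [Sum.elim_inl, m, v, Real.coe_toNNReal _ hvr.le]
      field_simp
    · simp only [Sum.elim_inr, m, v, Real.coe_toNNReal _ hvc.le]
      field_simp
  refine (MeasureTheory.measure_mono hsub).trans ?_
  refine (MeasureTheory.measure_biUnion_finset_le B T).trans ?_
  refine (Finset.sum_le_card_nsmul B _ _ hT).trans ?_
  rw [hexp, nsmul_eq_mul, mul_assoc]
  gcongr
  exact card_bases a

end
end
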